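/- arXiv:math/0406412 — 4 statements merged into one kernel-verified Lean document; each statement's English description precedes it below -/
import Mathlib

section
/- Let k be a field, let k[y] be a polynomial ring in one variable over k, let A be a k-subalgebra of k[y] whose fraction field (inside k(y)) equals k(y), and let B be an integral domain that is a k-algebra. Then there exists a nonzero u ∈ A such that: (i) the ideal k[y]·u of k[y] is contained in A; (ii) for every a ∈ A with k[y]·a ⊆ A, u divides a in k[y]; and (iii) for every f ∈ A ⊗_k B such that (k[y] ⊗_k B)·f ⊆ A ⊗_k B (inside k[y] ⊗_k B, with A ⊗_k B viewed as a subring of k[y] ⊗_k B), u divides f in k[y] ⊗_k B. -/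
open Polynomial TensorProduct

/-- An *exponential map* on a commutative `k`-algebra `A` is a `k`-algebra homomorphism
`φ : A → A[t]` such that evaluation at `t = 0` composed with `φ` is the identity, and
applying `φ` coefficientwise to `φ a` equals substituting `s + t` for `t` in `φ a`. -/
def IsExponential {k A : Type*} [CommRing k] [CommRing A] [Algebra k A]
    (φ : A →ₐ[k] A[X]) : Prop :=
  (∀ a : A, (φ a).eval 0 = a) ∧
  (∀ a : A, (φ a).map (φ : A →+* A[X]) =
      (φ a).eval₂ ((C : A[X] →+* A[X][X]).comp (C : A →+* A[X])) (X + C X))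

/-- The ring of `φ`-invariants `A^φ = {a : A | φ a = C a}`. -/
noncomputable def expInvariants {k A : Type*} [CommRing k] [CommRing A] [Algebra k A]
    (φ : A →ₐ[k] A[X]) : Subalgebra k A :=
  AlgHom.equalizer φ ((Algebra.ofId A A[X]).restrictScalars k)

/-- The AK invariant (ring of absolute constants) of a commutative `k`-algebra `A`:
the intersection of `A^φ` over all exponential maps `φ` on `A`. -/
noncomputable def AK (k A : Type*) [CommRing k] [CommRing A] [Algebra k A] : Subalgebra k A :=
  ⨅ φ : {ψ : A →ₐ[k] A[X] // IsExponential ψ}, expInvariants φ.1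

/-- `A` has transcendence degree 1 over `k`: some single element is a transcendence basis. -/
def TrdegOne (k A : Type*) [CommRing k] [CommRing A] [Algebra k A] : Prop :=
  ∃ x : A, IsTranscendenceBasis k (fun _ : Unit => x)

/-- The conductor of a subalgebra `A ⊆ k[y]`: the largest ideal of `k[y]` contained in `A`. -/
def conductorIdeal {k : Type*} [Field k] (A : Subalgebra k k[X]) : Ideal k[X] where
  carrier := {a | ∀ q : k[X], q * a ∈ A}
  zero_mem' q := by simp
  add_mem' ha hb q := by
    rw [mul_add]
    exact A.add_mem (ha q) (hb q)
  smul_mem' c a ha q := by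
    rw [smul_eq_mul, ← mul_assoc]
    exact ha (q * c)

/-- If `y = a / b` with `a, b ∈ A`, then `b ^ deg a` lies in the conductor. -/
theorem pow_natDegree_mem_conductorIdeal {k : Type*} [Field k] {A : Subalgebra k k[X]}
    {a b : k[X]} (ha : a ∈ A) (hb : b ∈ A) (hb0 : b ≠ 0) (hab : X * b = a) :
    b ^ a.natDegree ∈ conductorIdeal A := by
  have hdeg : 0 < a.natDegree := by
    rw [← hab, natDegree_X_mul hb0]
    exact Nat.succ_pos _
  have hpow : ∀ i < a.natDegree, X ^ i * b ^ a.natDegree ∈ A := by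
    intro i hi
    have h : X ^ i * b ^ a.natDegree = a ^ i * b ^ (a.natDegree - i) := by
      conv_lhs => rw [← Nat.add_sub_of_le hi.le, pow_add, ← mul_assoc, ← mul_pow, hab]
    rw [h]
    exact A.mul_mem (A.pow_mem ha _) (A.pow_mem hb _)
  have hlow : ∀ r : k[X], r.natDegree < a.natDegree → r * b ^ a.natDegree ∈ A := by
    intro r hr
    rw [r.as_sum_range_C_mul_X_pow, Finset.sum_mul]
    refine A.sum_mem fun i hi => ?_
    rw [mul_assoc, ← smul_eq_C_mul]
    exact A.smul_mem (hpow i (by rw [Finset.mem_range] at hi; omega)) _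
  intro q
  induction hn : q.natDegree using Nat.strong_induction_on generalizing q with
  | _ n ih =>
    subst hn
    by_cases hq : q.natDegree < a.natDegree
    · exact hlow q hq
    · have hq0 : q ≠ 0 := by
        rintro rfl
        exact hq (by simpa using hdeg)
      have hlt : (q / a).natDegree < q.natDegree := by
        rcases eq_or_ne (q / a) 0 with h0 | h0
        · rw [h0, natDegree_zero]
          omega
        · exact natDegree_lt_natDegree h0 (degree_div_lt hq0 (natDegree_pos_iff_degree_pos.1 hdeg))
      have hdiv := ih (q / a).natDegree hlt (q / a) rfl
      have hmod := hlow (q % a) (natDegree_mod_lt q hdeg.ne')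
      have h : q * b ^ a.natDegree =
          a * (q / a * b ^ a.natDegree) + q % a * b ^ a.natDegree := by
        conv_lhs => rw [← EuclideanDomain.div_add_mod q a]
        ring
      rw [h]
      exact A.add_mem (A.mul_mem ha hdiv) hmod

/-- The coordinates of an element of `A ⊗ B` with respect to a `k`-basis of `B` lie in `A`. -/
theorem basis_repr_mem_of_mem_range {k R B ι : Type*} [Field k] [CommRing R] [Algebra k R]
    [CommRing B] [Algebra k B] {A : Subalgebra k R} (b : Module.Basis ι k B) {f : R ⊗[k] B}
    (hf : f ∈ (Algebra.TensorProduct.map A.val (AlgHom.id k B)).range) (i : ι) :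
    (Algebra.TensorProduct.basis R b).repr f i ∈ A := by
  obtain ⟨z, rfl⟩ := hf
  induction z using TensorProduct.induction_on with
  | zero => simp
  | tmul x y =>
    simpa [Algebra.TensorProduct.basis_repr_tmul, ← Algebra.commutes, ← Algebra.smul_def] using
      A.smul_mem x.2 (b.repr y i)
  | add x y hx hy =>
    rw [map_add, map_add, Finsupp.add_apply]
    exact A.add_mem hx hy

/-- An element of `R ⊗ B` is divisible by `u ⊗ 1` if all its coordinates with respect to a basis
of `B` are divisible by `u`. -/
theorem tmul_one_dvd_of_dvd_basis_repr {k R B ι : Type*} [Field k] [CommRing R] [Algebra k R]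
    [CommRing B] [Algebra k B] (b : Module.Basis ι k B) {u : R} {f : R ⊗[k] B}
    (h : ∀ i, u ∣ (Algebra.TensorProduct.basis R b).repr f i) : u ⊗ₜ[k] (1 : B) ∣ f := by
  rw [← (Algebra.TensorProduct.basis R b).linearCombination_repr f,
    Finsupp.linearCombination_apply]
  refine Finset.dvd_sum fun i _ => ?_
  simp only [Algebra.smul_def]
  exact (map_dvd (algebraMap R (R ⊗[k] B)) (h i)).mul_right _


/-- **Lemma 6.** For a subalgebra `A ⊆ k[y]` with `Frac(A) = k(y)` there is a nonzero
`u ∈ A` such that (i) `k[y]·u ⊆ A`, (ii) `u` divides every `a ∈ A` with `k[y]·a ⊆ A`,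
and (iii) `u` divides every `f ∈ A ⊗ₖ B` with `(k[y] ⊗ₖ B)·f ⊆ A ⊗ₖ B`. -/
theorem exists_conductor_element
    {k B : Type*} [Field k] [CommRing B] [IsDomain B] [Algebra k B]
    (A : Subalgebra k (Polynomial k))
    (hfrac : ∀ q : RatFunc k, ∃ a b : Polynomial k, a ∈ A ∧ b ∈ A ∧ b ≠ 0 ∧
      q * algebraMap (Polynomial k) (RatFunc k) b = algebraMap (Polynomial k) (RatFunc k) a) :
    ∃ u : Polynomial k, u ∈ A ∧ u ≠ 0 ∧
      (∀ q : Polynomial k, q * u ∈ A) ∧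
      (∀ a : Polynomial k, a ∈ A → (∀ q : Polynomial k, q * a ∈ A) → u ∣ a) ∧
      (∀ f : Polynomial k ⊗[k] B,
        f ∈ (Algebra.TensorProduct.map A.val (AlgHom.id k B)).range →
        (∀ g : Polynomial k ⊗[k] B,
          g * f ∈ (Algebra.TensorProduct.map A.val (AlgHom.id k B)).range) →
        (u ⊗ₜ[k] (1 : B)) ∣ f) := by
  obtain ⟨a, b, ha, hb, hb0, hab⟩ := hfrac (algebraMap k[X] (RatFunc k) X)
  rw [← map_mul] at hab
  have hmem := pow_natDegree_mem_conductorIdeal ha hb hb0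
    (IsFractionRing.injective k[X] (RatFunc k) hab)
  obtain ⟨u, hu⟩ := (IsPrincipalIdealRing.principal (conductorIdeal A)).principal
  have hdvd : ∀ c : k[X], c ∈ conductorIdeal A ↔ u ∣ c := fun c => by
    rw [hu]
    exact Ideal.mem_span_singleton
  have huA : ∀ q : k[X], q * u ∈ A := (hdvd u).2 dvd_rfl
  refine ⟨u, by simpa using huA 1, ?_, huA, fun c _ hc => (hdvd c).1 hc, fun f _ hf => ?_⟩
  · exact ne_zero_of_dvd_ne_zero (pow_ne_zero _ hb0) ((hdvd _).1 hmem)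
  · refine tmul_one_dvd_of_dvd_basis_repr (Module.Basis.ofVectorSpace k B) fun i => ?_
    refine (hdvd _).1 fun q => ?_
    have h := basis_repr_mem_of_mem_range (Module.Basis.ofVectorSpace k B)
      (hf (algebraMap k[X] (k[X] ⊗[k] B) q)) i
    rwa [← Algebra.smul_def, map_smul, Finsupp.smul_apply, smul_eq_mul] at h
end

section
/- Let k be a field and let A and B be commutative k-algebras. Then AK(A ⊗_k B) is contained in the canonical image of AK(A) ⊗_k AK(B) in A ⊗_k B. -/
open Polynomial TensorProduct

section Exponential

variable {k A B : Type*} [CommRing k] [CommRing A] [Algebra k A] [CommRing B] [Algebra k B]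

theorem mem_expInvariants {φ : A →ₐ[k] A[X]} {a : A} : a ∈ expInvariants φ ↔ φ a = C a :=
  Iff.rfl

theorem mem_AK {a : A} : a ∈ AK k A ↔ ∀ φ : A →ₐ[k] A[X], IsExponential φ → φ a = C a := by
  simp [AK, Algebra.mem_iInf, mem_expInvariants]

/-- Both sides of the comodule axiom are additive and multiplicative, so the axioms of an
exponential map need only be checked on algebra generators. -/
theorem isExponential_of_adjoin_eq_top {φ : A →ₐ[k] A[X]} {s : Set A}
    (hs : Algebra.adjoin k s = ⊤) (h0 : ∀ a ∈ s, (φ a).eval 0 = a)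
    (h1 : ∀ a ∈ s, (φ a).map (φ : A →+* A[X]) =
      (φ a).eval₂ ((C : A[X] →+* A[X][X]).comp (C : A →+* A[X])) (X + C X)) :
    IsExponential φ := by
  refine ⟨fun a => ?_, fun a => ?_⟩ <;>
    induction (hs ▸ Algebra.mem_top : a ∈ Algebra.adjoin k s) using Algebra.adjoin_induction with
  | mem a ha => first | exact h0 a ha | exact h1 a ha
  | algebraMap r => simp [Polynomial.algebraMap_apply]
  | add a b _ _ ha hb => simp only [map_add, eval_add, Polynomial.map_add, eval₂_add, ha, hb]
  | mul a b _ _ ha hb => simp only [map_mul, eval_mul, Polynomial.map_mul, eval₂_mul, ha, hb]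

/-- If `Φ` restricts to the exponential map `φ` along `i`, then `Φ` satisfies the axioms of an
exponential map on the range of `i`. -/
theorem IsExponential.map_apply {φ : A →ₐ[k] A[X]} (hφ : IsExponential φ) {Φ : B →ₐ[k] B[X]}
    (i : A →ₐ[k] B) (h : ∀ a, Φ (i a) = (φ a).map (i : A →+* B)) (a : A) :
    (Φ (i a)).eval 0 = i a ∧ (Φ (i a)).map (Φ : B →+* B[X]) =
      (Φ (i a)).eval₂ ((C : B[X] →+* B[X][X]).comp (C : B →+* B[X])) (X + C X) := by
  constructor
  · rw [h, eval_map, eval₂_at_zero, coeff_zero_eq_eval_zero, hφ.1 a]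
    rfl
  · have hc : (Φ : B →+* B[X]).comp (i : A →+* B) =
        (mapRingHom (i : A →+* B)).comp (φ : A →+* A[X]) := RingHom.ext h
    have key := congrArg (Polynomial.map (mapRingHom (i : A →+* B))) (hφ.2 a)
    rw [h, Polynomial.map_map, hc, ← Polynomial.map_map, key, eval₂_map,
      ← coe_mapRingHom, hom_eval₂]
    congr 1
    · ext; simp
    · simp

/-- The AK invariant is preserved by isomorphisms. -/
theorem map_mem_AK (e : A ≃ₐ[k] B) {a : A} (ha : a ∈ AK k A) : e a ∈ AK k B := by
  rw [mem_AK] at ha ⊢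
  intro φ hφ
  let Φ : A →ₐ[k] A[X] := ((mapAlgHom (e.symm : B →ₐ[k] A)).comp φ).comp (e : A →ₐ[k] B)
  have hΦ (b : B) : Φ (e.symm b) = (φ b).map ((e.symm : B →ₐ[k] A) : B →+* A) := by
    simp [Φ]
  have hexp : IsExponential Φ := by
    refine ⟨fun a => ?_, fun a => ?_⟩
    · simpa using (hφ.map_apply (e.symm : B →ₐ[k] A) hΦ (e a)).1
    · simpa using (hφ.map_apply (e.symm : B →ₐ[k] A) hΦ (e a)).2
  have h := hΦ (e a)
  rw [e.symm_apply_apply, ha Φ hexp] at h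
  ext n
  have hn := congrArg (fun p => e (p.coeff n)) h
  simp only [coeff_map, coeff_C] at hn ⊢
  simpa [apply_ite e] using hn.symm

/-- The extension of an exponential map on `B` to `A ⊗ B`, trivial on `A`. -/
noncomputable def expTensor (A : Type*) [CommRing A] [Algebra k A] (ψ : B →ₐ[k] B[X]) :
    A ⊗[k] B →ₐ[k] (A ⊗[k] B)[X] :=
  Algebra.TensorProduct.lift (CAlgHom.comp Algebra.TensorProduct.includeLeft)
    ((mapAlgHom Algebra.TensorProduct.includeRight).comp ψ) fun _ _ => Commute.all _ _

theorem expTensor_tmul (ψ : B →ₐ[k] B[X]) (a : A) (b : B) :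
    expTensor A ψ (a ⊗ₜ b) =
      C (a ⊗ₜ 1) * (ψ b).map
        ((Algebra.TensorProduct.includeRight : B →ₐ[k] A ⊗[k] B) : B →+* A ⊗[k] B) := by
  simp [expTensor]

theorem IsExponential.expTensor {ψ : B →ₐ[k] B[X]} (hψ : IsExponential ψ) :
    IsExponential (expTensor A ψ) := by
  have hr (b : B) := hψ.map_apply (Φ := _root_.expTensor A ψ)
    (Algebra.TensorProduct.includeRight : B →ₐ[k] A ⊗[k] B)
    (fun b => by simp [expTensor_tmul, ← Algebra.TensorProduct.one_def]) b
  have hl (a : A) : _root_.expTensor A ψ (a ⊗ₜ 1) = C (a ⊗ₜ 1) := by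
    simp [expTensor_tmul]
  refine isExponential_of_adjoin_eq_top
    (s := Set.range (fun a : A => a ⊗ₜ[k] (1 : B)) ∪ Set.range (fun b : B => (1 : A) ⊗ₜ[k] b))
    ?_ ?_ ?_
  · refine top_unique fun x _ => ?_
    induction x using TensorProduct.induction_on with
    | zero => exact zero_mem _
    | add x y hx hy => exact add_mem (hx trivial) (hy trivial)
    | tmul a b =>
      rw [← mul_one a, ← one_mul b, ← Algebra.TensorProduct.tmul_mul_tmul]
      exact mul_mem (Algebra.subset_adjoin (Or.inl ⟨a, rfl⟩))
        (Algebra.subset_adjoin (Or.inr ⟨b, rfl⟩))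
  · rintro _ (⟨a, rfl⟩ | ⟨b, rfl⟩)
    · simp [hl]
    · exact (hr b).1
  · rintro _ (⟨a, rfl⟩ | ⟨b, rfl⟩)
    · simp [hl]
    · exact (hr b).2

/-- Applying a linear functional to the left factor. -/
noncomputable def leftSlice (B : Type*) [CommRing B] [Algebra k B] {M : Type*} [AddCommGroup M]
    [Module k M] (f : M →ₗ[k] k) : M ⊗[k] B →ₗ[k] B :=
  (TensorProduct.lid k B).toLinearMap ∘ₗ f.rTensor B

@[simp]
theorem leftSlice_tmul {M : Type*} [AddCommGroup M] [Module k M] (f : M →ₗ[k] k) (m : M) (b : B) :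
    leftSlice B f (m ⊗ₜ b) = f m • b := by
  simp [leftSlice]

theorem leftSlice_coeff_expTensor (ψ : B →ₐ[k] B[X]) (f : A →ₗ[k] k) (x : A ⊗[k] B) (n : ℕ) :
    leftSlice B f ((expTensor A ψ x).coeff n) = (ψ (leftSlice B f x)).coeff n := by
  induction x using TensorProduct.induction_on with
  | zero => simp
  | add x y hx hy => simp [hx, hy]
  | tmul a b => simp [expTensor_tmul]

theorem leftSlice_mem_AK (f : A →ₗ[k] k) {x : A ⊗[k] B} (hx : x ∈ AK k (A ⊗[k] B)) :
    leftSlice B f x ∈ AK k B := by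
  rw [mem_AK] at hx ⊢
  intro ψ hψ
  ext n
  rw [← leftSlice_coeff_expTensor, hx _ hψ.expTensor, coeff_C, coeff_C, apply_ite (leftSlice B f),
    map_zero]

end Exponential

/-- A tensor lies in `M ⊗ N` for a submodule `N` as soon as all its coordinates with respect to a
basis of `M` do. -/
theorem mem_range_lTensor_of_leftSlice_mem {k M B ι : Type*} [CommRing k] [AddCommGroup M]
    [Module k M] [CommRing B] [Algebra k B] (b : Module.Basis ι k M) (N : Submodule k B)
    (x : M ⊗[k] B) (h : ∀ i, leftSlice B (b.coord i) x ∈ N) :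
    x ∈ LinearMap.range (N.subtype.lTensor M) := by
  classical
  obtain ⟨c, rfl⟩ := TensorProduct.eq_repr_basis_left b x
  have hc (i : ι) : c i ∈ N := by
    have := h i
    simp only [Finsupp.sum, map_sum, leftSlice_tmul, Module.Basis.coord_apply,
      Module.Basis.repr_self, Finsupp.single_apply, ite_smul, one_smul, zero_smul,
      Finset.sum_ite_eq', Finsupp.mem_support_iff] at this
    by_cases hi : c i = 0
    · simp [hi]
    · simpa [hi] using this
  exact sum_mem fun i _ => ⟨b i ⊗ₜ ⟨c i, hc i⟩, rfl⟩

/-- The easy inclusion: `AK(A ⊗ₖ B)` is contained in the canonical image of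
`AK(A) ⊗ₖ AK(B)` in `A ⊗ₖ B`, for arbitrary commutative `k`-algebras `A`, `B`. -/
theorem ak_tensor_le
    {k A B : Type*} [Field k] [CommRing A] [Algebra k A] [CommRing B] [Algebra k B] :
    AK k (A ⊗[k] B) ≤
      (Algebra.TensorProduct.map (AK k A).val (AK k B).val).range := by
  intro x hx
  obtain ⟨z, hz⟩ := mem_range_lTensor_of_leftSlice_mem (Module.Basis.ofVectorSpace k B)
    (AK k A).toSubmodule (TensorProduct.comm k A B x) fun i =>
      leftSlice_mem_AK _ (map_mem_AK (Algebra.TensorProduct.comm k A B) hx)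
  let S := (AK k A).toSubmodule
  obtain ⟨y, rfl⟩ : ∃ y : S ⊗[k] B, S.subtype.rTensor B y = x := by
    refine ⟨TensorProduct.comm k B S z, (TensorProduct.comm k A B).injective ?_⟩
    rw [← hz, LinearMap.rTensor_comm, ← LinearEquiv.trans_apply, TensorProduct.comm_trans_comm]
    rfl
  have hy (f : S →ₗ[k] k) : leftSlice B f y ∈ AK k B := by
    obtain ⟨g, rfl⟩ := LinearMap.exists_extend f
    convert leftSlice_mem_AK g hx using 1
    simp [leftSlice, LinearMap.rTensor_comp]
  obtain ⟨w, rfl⟩ := mem_range_lTensor_of_leftSlice_mem (Module.Basis.ofVectorSpace k S)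
    (AK k B).toSubmodule y fun i => hy _
  refine ⟨w, ?_⟩
  change TensorProduct.map _ _ w = _
  rw [← LinearMap.comp_apply, LinearMap.rTensor_comp_lTensor]
  rfl
end

section
/- Let k be a field, let A be an integral domain that is a k-algebra, and let φ be an exponential map on A. Then deg_φ is a degree function on A: for all a, b ∈ A, deg_φ(ab) = deg_φ(a) + deg_φ(b) and deg_φ(a + b) ≤ max{deg_φ(a), deg_φ(b)}; moreover, A^φ consists exactly of the elements of A of nonpositive φ-degree. -/
open Polynomial TensorProduct

/-- `deg_φ` is a degree function on the domain `A`, and `A^φ` consists exactly of the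
elements of non-positive `φ`-degree. -/
theorem degPhi_is_degree_function
    {k A : Type*} [Field k] [CommRing A] [IsDomain A] [Algebra k A]
    (φ : A →ₐ[k] A[X]) (hφ : IsExponential φ) :
    (∀ a b : A, (φ (a * b)).degree = (φ a).degree + (φ b).degree) ∧
    (∀ a b : A, (φ (a + b)).degree ≤ max (φ a).degree (φ b).degree) ∧
    (∀ a : A, a ∈ expInvariants φ ↔ (φ a).degree ≤ 0) := by
  refine ⟨fun a b => by rw [map_mul, degree_mul], fun a b => by
    rw [map_add]; exact degree_add_le _ _, fun a => ?_⟩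
  have mem_iff : a ∈ expInvariants φ ↔ φ a = C a := Iff.rfl
  rw [mem_iff]
  refine ⟨fun h => h ▸ degree_C_le, fun h => ?_⟩
  have h0 := hφ.1 a
  rw [eq_C_of_degree_le_zero h, eval_C] at h0
  rw [eq_C_of_degree_le_zero h, h0]
end

section
/- Let k be a field and let n be a natural number. Then the AK invariant of the polynomial ring k[x₁,…,xₙ] equals k: AK(k[x₁,…,xₙ]) = k. -/
open Polynomial TensorProduct

namespace MvPolynomial

variable {k σ : Type*} [CommRing k] [DecidableEq σ]

/-- The translation `xᵢ ↦ xᵢ + t`, fixing the other variables. -/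
noncomputable def translation (i : σ) : MvPolynomial σ k →ₐ[k] (MvPolynomial σ k)[X] :=
  aeval fun j => Polynomial.C (X j) + if j = i then Polynomial.X else 0

theorem translation_X (i j : σ) : translation (k := k) i (X j) =
    Polynomial.C (X j) + if j = i then Polynomial.X else 0 := by
  simp [translation]

theorem isExponential_translation (i : σ) : IsExponential (translation (k := k) i) := by
  constructor
  · intro a
    have h : (Polynomial.evalRingHom 0).comp (translation (k := k) i).toRingHom =
        RingHom.id _ := by
      apply ringHom_ext
      · intro r
        simp
      · intro j
        by_cases hj : j = i <;> simp [translation_X, hj]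
    exact DFunLike.congr_fun h a
  · intro a
    have h : (Polynomial.mapRingHom (translation (k := k) i).toRingHom).comp
          (translation (k := k) i).toRingHom =
        (Polynomial.eval₂RingHom (S := (MvPolynomial σ k)[X][X])
          (Polynomial.C.comp Polynomial.C)
          (Polynomial.X + Polynomial.C Polynomial.X)).comp (translation (k := k) i).toRingHom := by
      apply ringHom_ext
      · intro r
        simp
      · intro j
        by_cases hj : j = i
        · simp [translation_X, hj]
          ring
        · simp [translation_X, hj]
    exact DFunLike.congr_fun h a

/-- A polynomial invariant under translation of `xᵢ` is unchanged by setting `xᵢ = 0`. -/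
theorem aeval_update_zero_of_mem_expInvariants {i : σ} {f : MvPolynomial σ k}
    (hf : f ∈ expInvariants (translation (k := k) i)) :
    aeval (Function.update X i 0) f = f := by
  have h : ((Polynomial.aeval (-X i : MvPolynomial σ k)).restrictScalars k).comp
      (translation (k := k) i) = aeval (Function.update X i 0) := by
    apply algHom_ext
    intro j
    by_cases hj : j = i
    · subst hj
      simp [translation_X]
    · simp [translation_X, hj]
  have hf' : translation i f = Polynomial.C f := hf
  rw [← h, AlgHom.comp_apply, hf']
  simp

theorem mem_bot_of_forall_mem_expInvariants [Fintype σ] {f : MvPolynomial σ k}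
    (hf : ∀ i, f ∈ expInvariants (translation (k := k) i)) :
    f ∈ (⊥ : Subalgebra k (MvPolynomial σ k)) := by
  have key (s : Finset σ) :
      aeval (fun j => if j ∈ s then 0 else (X j : MvPolynomial σ k)) f = f := by
    induction s using Finset.induction_on with
    | empty => simp
    | insert i s _ ih =>
      have h : (aeval fun j => if j ∈ insert i s then 0 else (X j : MvPolynomial σ k)) =
          (aeval fun j => if j ∈ s then 0 else (X j : MvPolynomial σ k)).comp
            (aeval (Function.update (X : σ → MvPolynomial σ k) i 0)) := by
        apply algHom_ext
        intro j
        by_cases hj : j = i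
        · subst hj
          simp
        · simp [hj]
      rw [h, AlgHom.comp_apply, aeval_update_zero_of_mem_expInvariants (hf i), ih]
  have h := key Finset.univ
  simp only [Finset.mem_univ, if_true] at h
  rw [Algebra.mem_bot]
  exact ⟨constantCoeff f, (aeval_zero' (R := k) f).symm.trans h⟩

end MvPolynomial

/-- The AK invariant of the polynomial ring `k[x₁, …, xₙ]` is `k`. -/
theorem ak_mvPolynomial_eq_bot
    (k : Type*) [Field k] (n : ℕ) :
    AK k (MvPolynomial (Fin n) k) = ⊥ := by
  refine eq_bot_iff.2 fun f hf => MvPolynomial.mem_bot_of_forall_mem_expInvariants fun i => ?_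
  exact Algebra.mem_iInf.1 hf ⟨_, MvPolynomial.isExponential_translation i⟩
end
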